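/- arXiv:2410.22750 — 8 statements merged into one kernel-verified Lean document; each statement's English description precedes it below -/
import Mathlib

section
/- For all 0 ≤ s < t and all x, y ∈ ℝ, the kernel satisfies |G_{t−s}(x, y)| ≤ C_{a₁,a₂} · (t−s)^{−1/2} · exp(−(f(x) − f(y))²/(2(t−s))), where C_{a₁,a₂} = ((1+|β|)/√(2π)) · (1/√a₁ + 1/√a₂). -/
open Real MeasureTheory

/-- The piecewise rescaling `f(y) = y/√a₁` for `y ≤ 0` and `y/√a₂` for `y > 0`. -/
noncomputable def f (a₁ a₂ y : ℝ) : ℝ :=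
  if y ≤ 0 then y / Real.sqrt a₁ else y / Real.sqrt a₂

/-- The constant `β = (√a₁ + √a₂(α−1))/(√a₁ − √a₂(α−1))` with `α = 1 − ρ₁a₁/(ρ₂a₂)`. -/
noncomputable def beta (a₁ a₂ ρ₁ ρ₂ : ℝ) : ℝ :=
  (Real.sqrt a₁ + Real.sqrt a₂ * ((1 - ρ₁ * a₁ / (ρ₂ * a₂)) - 1)) /
  (Real.sqrt a₁ - Real.sqrt a₂ * ((1 - ρ₁ * a₁ / (ρ₂ * a₂)) - 1))

/-- The fundamental solution `G_t(x,y)` of `∂ₜu = 𝓛u`. -/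
noncomputable def G (a₁ a₂ ρ₁ ρ₂ t x y : ℝ) : ℝ :=
  (Real.sqrt (2 * Real.pi * t))⁻¹ *
    ((if y ≤ 0 then 1 / Real.sqrt a₁ else 0) + (if 0 < y then 1 / Real.sqrt a₂ else 0)) *
    (Real.exp (-(f a₁ a₂ x - f a₁ a₂ y) ^ 2 / (2 * t)) +
      beta a₁ a₂ ρ₁ ρ₂ * Real.sign y *
        Real.exp (-(|f a₁ a₂ x| + |f a₁ a₂ y|) ^ 2 / (2 * t)))

/-- Lemma 2.1: pointwise Gaussian bound for the kernel `G`. -/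
theorem stmt_0 (a₁ a₂ ρ₁ ρ₂ : ℝ) (ha₁ : 0 < a₁) (ha₂ : 0 < a₂)
    (hρ₁ : 0 < ρ₁) (hρ₂ : 0 < ρ₂) (s t x y : ℝ) (hs : 0 ≤ s) (hst : s < t) :
    |G a₁ a₂ ρ₁ ρ₂ (t - s) x y| ≤
      ((1 + |beta a₁ a₂ ρ₁ ρ₂|) / Real.sqrt (2 * Real.pi)) *
        (1 / Real.sqrt a₁ + 1 / Real.sqrt a₂) * (t - s) ^ (-(1 : ℝ) / 2) *
        Real.exp (-(f a₁ a₂ x - f a₁ a₂ y) ^ 2 / (2 * (t - s))) := by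
  have hu : 0 < t - s := sub_pos.mpr hst
  unfold G
  generalize t - s = u at hu
  generalize beta a₁ a₂ ρ₁ ρ₂ = b
  generalize f a₁ a₂ x = p
  generalize f a₁ a₂ y = q
  have h1 : 0 < 1 / Real.sqrt a₁ := by positivity
  have h2 : 0 < 1 / Real.sqrt a₂ := by positivity
  generalize 1 / Real.sqrt a₁ = c at h1
  generalize 1 / Real.sqrt a₂ = d at h2
  have hpow : u ^ (-(1 : ℝ) / 2) = (Real.sqrt u)⁻¹ := by
    rw [neg_div, Real.rpow_neg hu.le, Real.sqrt_eq_rpow]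
  have hsq : (Real.sqrt (2 * Real.pi * u))⁻¹
      = (Real.sqrt (2 * Real.pi))⁻¹ * (Real.sqrt u)⁻¹ := by
    rw [Real.sqrt_mul (by positivity), mul_inv]
  have hW0 : 0 ≤ (if y ≤ 0 then c else 0) + (if 0 < y then d else 0) := by
    split_ifs <;> linarith
  have hW : (if y ≤ 0 then c else 0) + (if 0 < y then d else 0) ≤ c + d := by
    split_ifs <;> linarith
  have hsign : |Real.sign y| ≤ 1 := by
    rcases Real.sign_apply_eq y with h | h | h <;> rw [h] <;> norm_num
  have hexp : Real.exp (-(|p| + |q|) ^ 2 / (2 * u)) ≤ Real.exp (-(p - q) ^ 2 / (2 * u)) := by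
    apply Real.exp_le_exp.mpr
    apply div_le_div_of_nonneg_right _ (by positivity)
    apply neg_le_neg
    apply sq_le_sq'
    · have := neg_abs_le p
      have := le_abs_self q
      linarith
    · have := neg_abs_le q
      have := le_abs_self p
      linarith
  have hE : 0 < Real.exp (-(|p| + |q|) ^ 2 / (2 * u)) := Real.exp_pos _
  have hF : 0 < Real.exp (-(p - q) ^ 2 / (2 * u)) := Real.exp_pos _
  generalize Real.exp (-(|p| + |q|) ^ 2 / (2 * u)) = E at *
  generalize Real.exp (-(p - q) ^ 2 / (2 * u)) = F at *
  have hB : |F + b * Real.sign y * E| ≤ (1 + |b|) * F := by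
    calc |F + b * Real.sign y * E| ≤ |F| + |b * Real.sign y * E| := abs_add_le _ _
      _ = F + |b| * |Real.sign y| * E := by
        rw [abs_mul, abs_mul, abs_of_pos hF, abs_of_pos hE]
      _ ≤ F + |b| * 1 * F := by gcongr
      _ = (1 + |b|) * F := by ring
  rw [hpow, hsq, abs_mul, abs_mul, abs_of_nonneg hW0, abs_of_nonneg (by positivity)]
  calc _ ≤ (Real.sqrt (2 * Real.pi))⁻¹ * (Real.sqrt u)⁻¹ * (c + d) * ((1 + |b|) * F) := by
        gcongr
    _ = _ := by ring
end

section
/- For all 0 ≤ s < t and all x, z ∈ ℝ, both ∫_ℝ |G_{t−s}(x, y)| dy ≤ C and ∫_ℝ |G_{t−s}(y, z)| dy ≤ C, where C = (1/√a₁ + 1/√a₂)(1 + |β|) · max(√a₁, √a₂). -/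
open Real MeasureTheory

lemma gauss_aux (a₁ a₂ : ℝ) (ha₁ : 0 < a₁) (ha₂ : 0 < a₂) (T c : ℝ) (hT : 0 < T) :
    Integrable (fun y => Real.exp (-(c - f a₁ a₂ y) ^ 2 / (2 * T))) ∧
    (∫ y, Real.exp (-(c - f a₁ a₂ y) ^ 2 / (2 * T))) ≤
      max (Real.sqrt a₁) (Real.sqrt a₂) * Real.sqrt (2 * Real.pi * T) := by
  have hp : 0 < Real.sqrt a₁ := Real.sqrt_pos.2 ha₁
  have hq : 0 < Real.sqrt a₂ := Real.sqrt_pos.2 ha₂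
  set p := Real.sqrt a₁ with hpd
  set q := Real.sqrt a₂ with hqd
  let g : ℝ → ℝ := fun u => Real.exp (-(1 / (2 * T)) * (u - c) ^ 2)
  have hgnn : ∀ u, 0 ≤ g u := fun u => (Real.exp_pos _).le
  have hb : 0 < 1 / (2 * T) := by positivity
  have hgi : Integrable g := (integrable_exp_neg_mul_sq hb).comp_sub_right c
  have hgv : ∫ u, g u = Real.sqrt (2 * Real.pi * T) := by
    have h1 := integral_sub_right_eq_self (μ := volume)
      (fun u : ℝ => Real.exp (-(1 / (2 * T)) * u ^ 2)) c
    have h2 := integral_gaussian (1 / (2 * T))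
    change ∫ u, Real.exp (-(1 / (2 * T)) * (u - c) ^ 2) = _
    rw [h1, h2]
    congr 1
    field_simp
  let I₁ : ℝ → ℝ := (Set.Iic 0).indicator g
  let I₂ : ℝ → ℝ := (Set.Ioi 0).indicator g
  have hI₁ : Integrable I₁ := hgi.indicator measurableSet_Iic
  have hI₂ : Integrable I₂ := hgi.indicator measurableSet_Ioi
  have hn₁ : 0 ≤ ∫ u, I₁ u := integral_nonneg (fun u => Set.indicator_nonneg (fun _ _ => hgnn _) u)
  have hn₂ : 0 ≤ ∫ u, I₂ u := integral_nonneg (fun u => Set.indicator_nonneg (fun _ _ => hgnn _) u)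
  have hsum : (∫ u, I₁ u) + ∫ u, I₂ u = Real.sqrt (2 * Real.pi * T) := by
    rw [← hgv, ← integral_add hI₁ hI₂]
    congr 1
    funext u
    by_cases hu : u ≤ 0
    · simp [I₁, I₂, hu]
    · simp [I₁, I₂, hu, not_le.1 hu]
  have heq : (fun y => Real.exp (-(c - f a₁ a₂ y) ^ 2 / (2 * T))) =
      fun y => I₁ (y / p) + I₂ (y / q) := by
    funext y
    by_cases hy : y ≤ 0
    · have h1 : y / p ≤ 0 := div_nonpos_of_nonpos_of_nonneg hy hp.le
      have h2 : y / q ≤ 0 := div_nonpos_of_nonpos_of_nonneg hy hq.le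
      have e1 : I₁ (y / p) = g (y / p) := Set.indicator_of_mem (by exact h1) g
      have e2 : I₂ (y / q) = 0 := Set.indicator_of_notMem (by simpa using h2) g
      rw [e1, e2]
      simp only [f, hy, if_true, g, add_zero]
      congr 1
      rw [← hpd]
      ring
    · have h1 : 0 < y / p := div_pos (not_le.1 hy) hp
      have h2 : 0 < y / q := div_pos (not_le.1 hy) hq
      have e1 : I₁ (y / p) = 0 := Set.indicator_of_notMem (by simpa using h1) g
      have e2 : I₂ (y / q) = g (y / q) := Set.indicator_of_mem (by exact h2) g
      rw [e1, e2]
      simp only [f, hy, if_false, g, zero_add]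
      congr 1
      rw [← hqd]
      ring
  rw [heq]
  have j₁ := hI₁.comp_div hp.ne'
  have j₂ := hI₂.comp_div hq.ne'
  refine ⟨j₁.add j₂, ?_⟩
  rw [integral_add j₁ j₂, Measure.integral_comp_div, Measure.integral_comp_div, abs_of_pos hp,
    abs_of_pos hq, smul_eq_mul, smul_eq_mul, ← hsum, mul_add]
  exact add_le_add (mul_le_mul_of_nonneg_right (le_max_left _ _) hn₁)
    (mul_le_mul_of_nonneg_right (le_max_right _ _) hn₂)

lemma G_abs_le (a₁ a₂ ρ₁ ρ₂ : ℝ) (T x y : ℝ) (hT : 0 < T) :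
    |G a₁ a₂ ρ₁ ρ₂ T x y| ≤ (Real.sqrt (2 * Real.pi * T))⁻¹ *
      (1 / Real.sqrt a₁ + 1 / Real.sqrt a₂) * (1 + |beta a₁ a₂ ρ₁ ρ₂|) *
      Real.exp (-(f a₁ a₂ x - f a₁ a₂ y) ^ 2 / (2 * T)) := by
  unfold G
  set b := beta a₁ a₂ ρ₁ ρ₂
  set u := f a₁ a₂ x
  set v := f a₁ a₂ y
  have hp : 0 ≤ 1 / Real.sqrt a₁ := by positivity
  have hq : 0 ≤ 1 / Real.sqrt a₂ := by positivity
  have hE : Real.exp (-(|u| + |v|) ^ 2 / (2 * T)) ≤ Real.exp (-(u - v) ^ 2 / (2 * T)) := by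
    apply Real.exp_le_exp.2
    have h : (u - v) ^ 2 ≤ (|u| + |v|) ^ 2 := by
      rw [← sq_abs (u - v)]
      exact pow_le_pow_left₀ (abs_nonneg _) (abs_sub u v) 2
    gcongr
  have hs : |Real.sign y| ≤ 1 := by
    rcases Real.sign_apply_eq y with h | h | h <;> simp [h]
  have hw : |(if y ≤ 0 then 1 / Real.sqrt a₁ else 0) + (if 0 < y then 1 / Real.sqrt a₂ else 0)|
      ≤ 1 / Real.sqrt a₁ + 1 / Real.sqrt a₂ := by
    by_cases hy : y ≤ 0
    · rw [if_pos hy, if_neg (not_lt.2 hy), add_zero, abs_of_nonneg hp]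
      linarith
    · rw [if_neg hy, if_pos (not_le.1 hy), zero_add, abs_of_nonneg hq]
      linarith
  have hB : |Real.exp (-(u - v) ^ 2 / (2 * T)) +
      b * Real.sign y * Real.exp (-(|u| + |v|) ^ 2 / (2 * T))| ≤
      (1 + |b|) * Real.exp (-(u - v) ^ 2 / (2 * T)) := by
    refine (abs_add_le _ _).trans ?_
    rw [abs_mul, abs_mul, Real.abs_exp, Real.abs_exp, add_mul, one_mul]
    have : |b| * |Real.sign y| ≤ |b| := mul_le_of_le_one_right (abs_nonneg _) hs
    gcongr
  rw [abs_mul, abs_mul, abs_of_nonneg (by positivity : 0 ≤ (Real.sqrt (2 * Real.pi * T))⁻¹),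
    mul_assoc _ (1 + |b|)]
  gcongr

/-- Lemma 2.2: uniform bound of the spatial `L¹` norms of the kernel `G`,
in both the second and the first spatial argument. -/
theorem stmt_1 (a₁ a₂ ρ₁ ρ₂ : ℝ) (ha₁ : 0 < a₁) (ha₂ : 0 < a₂)
    (hρ₁ : 0 < ρ₁) (hρ₂ : 0 < ρ₂) (s t x z : ℝ) (hs : 0 ≤ s) (hst : s < t) :
    (∫ y, |G a₁ a₂ ρ₁ ρ₂ (t - s) x y|) ≤
        (1 / Real.sqrt a₁ + 1 / Real.sqrt a₂) * (1 + |beta a₁ a₂ ρ₁ ρ₂|) *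
          max (Real.sqrt a₁) (Real.sqrt a₂) ∧
    (∫ y, |G a₁ a₂ ρ₁ ρ₂ (t - s) y z|) ≤
        (1 / Real.sqrt a₁ + 1 / Real.sqrt a₂) * (1 + |beta a₁ a₂ ρ₁ ρ₂|) *
          max (Real.sqrt a₁) (Real.sqrt a₂) := by
  have hT : 0 < t - s := sub_pos.2 hst
  set T := t - s
  set K := (Real.sqrt (2 * Real.pi * T))⁻¹ *
      (1 / Real.sqrt a₁ + 1 / Real.sqrt a₂) * (1 + |beta a₁ a₂ ρ₁ ρ₂|) with hK
  have hK0 : 0 ≤ K := by positivity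
  have hr : 0 < Real.sqrt (2 * Real.pi * T) := Real.sqrt_pos.2 (by positivity)
  have hfin : ∀ c, ∀ F : ℝ → ℝ,
      (∀ y, |F y| ≤ K * Real.exp (-(c - f a₁ a₂ y) ^ 2 / (2 * T))) →
      (∫ y, |F y|) ≤ (1 / Real.sqrt a₁ + 1 / Real.sqrt a₂) * (1 + |beta a₁ a₂ ρ₁ ρ₂|) *
          max (Real.sqrt a₁) (Real.sqrt a₂) := by
    intro c F hF
    obtain ⟨hi, hv⟩ := gauss_aux a₁ a₂ ha₁ ha₂ T c hT
    have h1 := integral_mono_of_nonneg (μ := volume)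
      (Filter.Eventually.of_forall (fun y => abs_nonneg (F y))) (hi.const_mul K)
      (Filter.Eventually.of_forall hF)
    refine h1.trans ?_
    rw [integral_const_mul]
    refine (mul_le_mul_of_nonneg_left hv hK0).trans (le_of_eq ?_)
    rw [hK]
    generalize 1 / Real.sqrt a₁ + 1 / Real.sqrt a₂ = w
    field_simp
  refine ⟨hfin (f a₁ a₂ x) _ fun y => G_abs_le a₁ a₂ ρ₁ ρ₂ T x y hT,
    hfin (f a₁ a₂ z) _ fun y => ?_⟩
  have h := G_abs_le a₁ a₂ ρ₁ ρ₂ T y z hT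
  rwa [sub_sq_comm] at h
end

section
/- Suppose φ₁, φ₂, … : [0, T] → [0, ∞) are measurable and non-decreasing, and there exists a constant A ≥ 0 such that for all integers n ≥ 1 and all t ∈ [0, T], φ_{n+1}(t) ≤ A ∫₀ᵗ φ_n(s) ds. Then for every exponent p > 0 and every t ∈ [0, T], the series Σ_{n≥1} φ_n(t)^p converges. -/
open Real MeasureTheory intervalIntegral

/-- Under the hypotheses of the Gronwall-type lemma, for every exponent `p > 0`
and every `t ∈ [0,T]` the series `Σ_{n≥1} φₙ(t)^p` converges. -/
theorem stmt_4 (T : ℝ) (hT : 0 < T) (φ : ℕ → ℝ → ℝ) (A : ℝ) (hA : 0 ≤ A)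
    (hmeas : ∀ n, Measurable (φ n))
    (hnonneg : ∀ n, ∀ t ∈ Set.Icc (0 : ℝ) T, 0 ≤ φ n t)
    (hmono : ∀ n, MonotoneOn (φ n) (Set.Icc (0 : ℝ) T))
    (hrec : ∀ n ≥ 1, ∀ t ∈ Set.Icc (0 : ℝ) T,
      φ (n + 1) t ≤ A * ∫ s in (0 : ℝ)..t, φ n s) :
    ∀ p : ℝ, 0 < p → ∀ t ∈ Set.Icc (0 : ℝ) T,
      Summable (fun n : ℕ => (φ (n + 1) t) ^ p) := by
  have key : ∀ n : ℕ, ∀ t ∈ Set.Icc (0 : ℝ) T,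
      φ (n + 1) t ≤ φ 1 T * A ^ n / (n.factorial : ℝ) * t ^ n := by
    intro n
    induction n with
    | zero =>
      intro t ht
      simpa using hmono 1 ht ⟨hT.le, le_refl T⟩ ht.2
    | succ n ih =>
      intro t ht
      have hsub : Set.Icc (0 : ℝ) t ⊆ Set.Icc 0 T := Set.Icc_subset_Icc le_rfl ht.2
      have hint : IntervalIntegrable (φ (n + 1)) volume 0 t := by
        apply MonotoneOn.intervalIntegrable
        rw [Set.uIcc_of_le ht.1]
        exact (hmono (n + 1)).mono hsub
      have h1 : ∫ s in (0 : ℝ)..t, φ (n + 1) s ≤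
          ∫ s in (0 : ℝ)..t, φ 1 T * A ^ n / (n.factorial : ℝ) * s ^ n := by
        apply intervalIntegral.integral_mono_on ht.1 hint
        · exact (by fun_prop : Continuous fun s : ℝ =>
            φ 1 T * A ^ n / (n.factorial : ℝ) * s ^ n).intervalIntegrable _ _
        · intro s hs
          exact ih s (hsub hs)
      refine (hrec (n + 1) (by omega) t ht).trans
        ((mul_le_mul_of_nonneg_left h1 hA).trans (le_of_eq ?_))
      rw [intervalIntegral.integral_const_mul, integral_pow, Nat.factorial_succ]
      have : (n.factorial : ℝ) ≠ 0 := by positivity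
      push_cast
      field_simp
      simp
      ring
  intro p hp t ht
  have hC : 0 ≤ φ 1 T := hnonneg 1 T ⟨hT.le, le_refl T⟩
  have hx : 0 ≤ A * t := mul_nonneg hA ht.1
  have hK : 0 ≤ φ 1 T * Real.exp (2 * (A * t)) := by positivity
  have hbound : ∀ n : ℕ, φ (n + 1) t ≤ φ 1 T * Real.exp (2 * (A * t)) * (1 / 2) ^ n := by
    intro n
    refine (key n t ht).trans ?_
    have h := Real.pow_div_factorial_le_exp (2 * (A * t)) (by positivity) n
    calc φ 1 T * A ^ n / (n.factorial : ℝ) * t ^ n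
        = φ 1 T * ((2 * (A * t)) ^ n / (n.factorial : ℝ)) * (1 / 2) ^ n := by
          rw [mul_pow, mul_pow, one_div, inv_pow]
          field_simp
      _ ≤ _ := by gcongr
  refine Summable.of_nonneg_of_le
    (f := fun n : ℕ => (φ 1 T * Real.exp (2 * (A * t))) ^ p * (((1 / 2 : ℝ) ^ p) ^ n))
    (fun n => Real.rpow_nonneg (hnonneg _ t ht) p) (fun n => ?_) ?_
  · refine (Real.rpow_le_rpow (hnonneg _ t ht) (hbound n) hp.le).trans (le_of_eq ?_)
    rw [Real.mul_rpow hK (by positivity), ← Real.rpow_natCast, ← Real.rpow_natCast,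
      ← Real.rpow_mul (by norm_num), ← Real.rpow_mul (by norm_num), mul_comm p]
  · apply Summable.mul_left
    exact summable_geometric_of_lt_one (by positivity)
      (Real.rpow_lt_one (by norm_num) (by norm_num) hp)
end

section
/- For every t > 0 and every x ∈ ℝ, ∫_ℝ exp(−(f(x) − f(z))²/(2t)) dz ≤ max(√a₁, √a₂) · √(2πt). -/
open Real MeasureTheory

theorem f_gap_aux (a₁ a₂ : ℝ) (ha₁ : 0 < a₁) (ha₂ : 0 < a₂) (x y : ℝ) (hxy : x ≤ y) :
    (y - x) / max (Real.sqrt a₁) (Real.sqrt a₂) ≤ f a₁ a₂ y - f a₁ a₂ x := by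
  have h1 : 0 < Real.sqrt a₁ := Real.sqrt_pos.2 ha₁
  have h2 : 0 < Real.sqrt a₂ := Real.sqrt_pos.2 ha₂
  have i1 : (max (Real.sqrt a₁) (Real.sqrt a₂))⁻¹ ≤ (Real.sqrt a₁)⁻¹ :=
    inv_anti₀ h1 (le_max_left _ _)
  have i2 : (max (Real.sqrt a₁) (Real.sqrt a₂))⁻¹ ≤ (Real.sqrt a₂)⁻¹ :=
    inv_anti₀ h2 (le_max_right _ _)
  unfold f
  simp only [div_eq_mul_inv]
  split_ifs with hy hx hx
  · nlinarith
  · linarith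
  · nlinarith
  · nlinarith

theorem f_gap_sq_aux (a₁ a₂ : ℝ) (ha₁ : 0 < a₁) (ha₂ : 0 < a₂) (x z : ℝ) :
    ((z - x) / max (Real.sqrt a₁) (Real.sqrt a₂)) ^ 2 ≤ (f a₁ a₂ x - f a₁ a₂ z) ^ 2 := by
  have hM : 0 < max (Real.sqrt a₁) (Real.sqrt a₂) := lt_max_of_lt_left (Real.sqrt_pos.2 ha₁)
  rcases le_total x z with h | h
  · have := f_gap_aux a₁ a₂ ha₁ ha₂ x z h
    have h0 : 0 ≤ (z - x) / max (Real.sqrt a₁) (Real.sqrt a₂) :=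
      div_nonneg (sub_nonneg.2 h) hM.le
    nlinarith
  · have := f_gap_aux a₁ a₂ ha₁ ha₂ z x h
    have h0 : 0 ≤ (x - z) / max (Real.sqrt a₁) (Real.sqrt a₂) :=
      div_nonneg (sub_nonneg.2 h) hM.le
    have e : (z - x) / max (Real.sqrt a₁) (Real.sqrt a₂)
      = -((x - z) / max (Real.sqrt a₁) (Real.sqrt a₂)) := by ring
    rw [e]
    nlinarith

/-- Gaussian-type integral bound: `∫_ℝ exp(−(f(x)−f(z))²/(2t)) dz ≤ max(√a₁,√a₂)·√(2πt)`. -/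
theorem stmt_6 (a₁ a₂ : ℝ) (ha₁ : 0 < a₁) (ha₂ : 0 < a₂) (t x : ℝ) (ht : 0 < t) :
    (∫ z, Real.exp (-(f a₁ a₂ x - f a₁ a₂ z) ^ 2 / (2 * t))) ≤
      max (Real.sqrt a₁) (Real.sqrt a₂) * Real.sqrt (2 * Real.pi * t) := by
  have hM : 0 < max (Real.sqrt a₁) (Real.sqrt a₂) := lt_max_of_lt_left (Real.sqrt_pos.2 ha₁)
  have key := f_gap_sq_aux a₁ a₂ ha₁ ha₂ x
  set M := max (Real.sqrt a₁) (Real.sqrt a₂) with hMdef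
  have hb : 0 < 1 / (2 * t * M ^ 2) := by positivity
  have hint : Integrable (fun z : ℝ => Real.exp (-(1 / (2 * t * M ^ 2)) * (z - x) ^ 2)) :=
    (integrable_exp_neg_mul_sq hb).comp_sub_right x
  calc (∫ z, Real.exp (-(f a₁ a₂ x - f a₁ a₂ z) ^ 2 / (2 * t)))
      ≤ ∫ z : ℝ, Real.exp (-(1 / (2 * t * M ^ 2)) * (z - x) ^ 2) := by
        refine integral_mono_of_nonneg (Filter.Eventually.of_forall fun z => (Real.exp_pos _).le)
          hint (Filter.Eventually.of_forall fun z => ?_)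
        refine Real.exp_le_exp.2 ?_
        have e : -(1 / (2 * t * M ^ 2)) * (z - x) ^ 2 = -((z - x) / M) ^ 2 / (2 * t) := by
          field_simp
        rw [e]
        exact div_le_div_of_nonneg_right (neg_le_neg (key z)) (by positivity)
    _ = ∫ z : ℝ, Real.exp (-(1 / (2 * t * M ^ 2)) * z ^ 2) :=
        integral_sub_right_eq_self (fun z : ℝ => Real.exp (-(1 / (2 * t * M ^ 2)) * z ^ 2)) x
    _ = M * Real.sqrt (2 * Real.pi * t) := by
        rw [integral_gaussian]
        have e : Real.pi / (1 / (2 * t * M ^ 2)) = M ^ 2 * (2 * Real.pi * t) := by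
          field_simp
        rw [e, Real.sqrt_mul (by positivity), Real.sqrt_sq hM.le]
end

section
/- For every u > 0 and all x, z ∈ ℝ, u^{−1/2} · exp(−(f(x) − f(z))²/(2u)) · |x − z| ≤ max(√a₁, √a₂) · e^{−1/2}. In particular, the quantity u^{−1/2} exp(−(f(x)−f(z))²/(2u)) |x − z| is bounded uniformly in u, x, z. -/
open Real MeasureTheory

lemma f_aux (a₁ a₂ : ℝ) (ha₁ : 0 < a₁) (ha₂ : 0 < a₂) (x z : ℝ) (h : z ≤ x) :
    x - z ≤ max (Real.sqrt a₁) (Real.sqrt a₂) * (f a₁ a₂ x - f a₁ a₂ z) := by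
  have hp := Real.sqrt_pos.2 ha₁
  have hq := Real.sqrt_pos.2 ha₂
  unfold f
  generalize Real.sqrt a₁ = p at *
  generalize Real.sqrt a₂ = q at *
  have h1 := le_max_left p q
  have h2 := le_max_right p q
  generalize max p q = M at *
  have key : ∀ r w : ℝ, 0 < r → r ≤ M → 0 ≤ w → w ≤ M * (w / r) := by
    intro r w hr hM hw
    calc w = r * (w / r) := by field_simp
      _ ≤ M * (w / r) := by gcongr
  split_ifs with hx hz hz
  · rw [← sub_div]
    exact key p _ hp h1 (by linarith)
  · exact absurd (h.trans hx) hz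
  · have e1 := key q x hq h2 (by linarith)
    have e2 := key p (-z) hp h1 (by linarith)
    rw [neg_div] at e2
    linarith
  · rw [← sub_div]
    exact key q _ hq h2 (by linarith)

lemma f_lip (a₁ a₂ : ℝ) (ha₁ : 0 < a₁) (ha₂ : 0 < a₂) (x z : ℝ) :
    |x - z| ≤ max (Real.sqrt a₁) (Real.sqrt a₂) * |f a₁ a₂ x - f a₁ a₂ z| := by
  have hM : 0 ≤ max (Real.sqrt a₁) (Real.sqrt a₂) := le_max_of_le_left (Real.sqrt_nonneg _)
  rcases le_total z x with h | h
  · rw [abs_of_nonneg (sub_nonneg.2 h)]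
    exact (f_aux a₁ a₂ ha₁ ha₂ x z h).trans (mul_le_mul_of_nonneg_left (le_abs_self _) hM)
  · rw [abs_sub_comm x z, abs_sub_comm (f a₁ a₂ x), abs_of_nonneg (sub_nonneg.2 h)]
    exact (f_aux a₁ a₂ ha₁ ha₂ z x h).trans (mul_le_mul_of_nonneg_left (le_abs_self _) hM)

lemma gauss_aux_s8 (t : ℝ) : Real.exp (-t ^ 2 / 2) * t ≤ Real.exp (-(1 : ℝ) / 2) := by
  have h : t ≤ Real.exp ((t ^ 2 - 1) / 2) := by
    nlinarith [Real.add_one_le_exp ((t ^ 2 - 1) / 2), sq_nonneg (t - 1)]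
  calc Real.exp (-t ^ 2 / 2) * t ≤ Real.exp (-t ^ 2 / 2) * Real.exp ((t ^ 2 - 1) / 2) := by gcongr
    _ = Real.exp (-(1 : ℝ) / 2) := by rw [← Real.exp_add]; ring_nf

/-- Uniform bound: `u^{-1/2} exp(−(f(x)−f(z))²/(2u)) |x−z| ≤ max(√a₁,√a₂)·e^{-1/2}`. -/
theorem stmt_8 (a₁ a₂ : ℝ) (ha₁ : 0 < a₁) (ha₂ : 0 < a₂) (u x z : ℝ) (hu : 0 < u) :
    u ^ (-(1 : ℝ) / 2) * Real.exp (-(f a₁ a₂ x - f a₁ a₂ z) ^ 2 / (2 * u)) * |x - z| ≤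
      max (Real.sqrt a₁) (Real.sqrt a₂) * Real.exp (-(1 : ℝ) / 2) := by
  have hM : 0 ≤ max (Real.sqrt a₁) (Real.sqrt a₂) := le_max_of_le_left (Real.sqrt_nonneg _)
  have hl := f_lip a₁ a₂ ha₁ ha₂ x z
  have hs := Real.sqrt_pos.2 hu
  have hpow : u ^ (-(1 : ℝ) / 2) = (Real.sqrt u)⁻¹ := by
    rw [neg_div, Real.rpow_neg hu.le, Real.sqrt_eq_rpow]
  have hg := gauss_aux_s8 (|f a₁ a₂ x - f a₁ a₂ z| / Real.sqrt u)
  have he : -(|f a₁ a₂ x - f a₁ a₂ z| / Real.sqrt u) ^ 2 / 2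
      = -(f a₁ a₂ x - f a₁ a₂ z) ^ 2 / (2 * u) := by
    rw [div_pow, sq_abs, Real.sq_sqrt hu.le]
    field_simp
  rw [he] at hg
  rw [hpow]
  refine (mul_le_mul_of_nonneg_left hl (by positivity)).trans ?_
  refine le_trans (le_of_eq ?_) (mul_le_mul_of_nonneg_left hg hM)
  ring
end

section
/- There exists a constant C > 0 depending only on a₁, a₂, ρ₁, ρ₂ such that for every t > 0, every x ∈ ℝ and every 0 < δ ≤ 1 with δ^{6/5} ≤ t, setting t(δ) = t − δ^{6/5}, one has ∫_{t(δ)}^{t+δ} ∫_ℝ G_{t+δ−r}(x, z)² dz dr ≤ C δ^{1/2}. Consequently, δ^{3/5} · ∫_{t(δ)}^{t+δ} ∫_ℝ G_{t+δ−r}(x, z)² dz dr ≤ C δ^{11/10}. -/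
open Real MeasureTheory

lemma aux_gauss (c u s : ℝ) (hc : 0 < c) (hs : 0 < s) :
    Integrable (fun z : ℝ => Real.exp (-(u - z / c) ^ 2 / s)) ∧
    ∫ z : ℝ, Real.exp (-(u - z / c) ^ 2 / s) = c * Real.sqrt (π * s) := by
  have e : ∀ z : ℝ, Real.exp (-(u - z / c) ^ 2 / s)
      = (fun w : ℝ => Real.exp (-(1 / (c ^ 2 * s)) * w ^ 2)) (z - c * u) := by
    intro z
    simp only
    congr 1
    field_simp
    ring
  have hb : 0 < 1 / (c ^ 2 * s) := by positivity
  simp_rw [e]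
  refine ⟨(integrable_exp_neg_mul_sq hb).comp_sub_right (c * u), ?_⟩
  rw [integral_sub_right_eq_self (fun w : ℝ => Real.exp (-(1 / (c ^ 2 * s)) * w ^ 2)) (c * u),
    integral_gaussian]
  rw [show π / (1 / (c ^ 2 * s)) = c ^ 2 * (π * s) by field_simp,
    Real.sqrt_mul (by positivity), Real.sqrt_sq hc.le]

noncomputable def auxM (a₁ a₂ ρ₁ ρ₂ : ℝ) : ℝ :=
  (1 / Real.sqrt a₁ + 1 / Real.sqrt a₂) ^ 2 * (1 + |beta a₁ a₂ ρ₁ ρ₂|) ^ 2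

lemma aux_pt (a₁ a₂ ρ₁ ρ₂ s x z : ℝ) (hs : 0 < s) :
    (G a₁ a₂ ρ₁ ρ₂ s x z) ^ 2 ≤ (2 * π * s)⁻¹ * auxM a₁ a₂ ρ₁ ρ₂ *
      (Real.exp (-(f a₁ a₂ x - z / Real.sqrt a₁) ^ 2 / s) +
       Real.exp (-(f a₁ a₂ x - z / Real.sqrt a₂) ^ 2 / s)) := by
  set u := f a₁ a₂ x with hu
  set v := f a₁ a₂ z with hv
  set E := Real.exp (-(u - v) ^ 2 / (2 * s)) with hE
  have hE0 : 0 < E := Real.exp_pos _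
  have hEE : E ^ 2 = Real.exp (-(u - v) ^ 2 / s) := by
    rw [hE, ← Real.exp_nat_mul]
    congr 1
    push_cast
    field_simp
  have hE2 : E ^ 2 ≤ Real.exp (-(u - z / Real.sqrt a₁) ^ 2 / s) +
       Real.exp (-(u - z / Real.sqrt a₂) ^ 2 / s) := by
    rw [hEE, hv, f]
    have h1 := Real.exp_pos (-(u - z / Real.sqrt a₁) ^ 2 / s)
    have h2 := Real.exp_pos (-(u - z / Real.sqrt a₂) ^ 2 / s)
    split_ifs <;> linarith
  have hF : Real.exp (-(|u| + |v|) ^ 2 / (2 * s)) ≤ E := by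
    apply Real.exp_le_exp.mpr
    have : (u - v) ^ 2 ≤ (|u| + |v|) ^ 2 := by
      rw [← sq_abs (u - v)]
      have := abs_sub u v
      gcongr
    gcongr
  have hF0 := Real.exp_pos (-(|u| + |v|) ^ 2 / (2 * s))
  have hsgn : |Real.sign z| ≤ 1 := by
    rcases Real.sign_apply_eq z with h | h | h <;> rw [h] <;> norm_num
  have hb : |E + beta a₁ a₂ ρ₁ ρ₂ * Real.sign z * Real.exp (-(|u| + |v|) ^ 2 / (2 * s))|
      ≤ (1 + |beta a₁ a₂ ρ₁ ρ₂|) * E := by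
    refine (abs_add_le _ _).trans ?_
    rw [abs_mul, abs_mul, abs_of_pos hE0, abs_of_pos hF0]
    have : |beta a₁ a₂ ρ₁ ρ₂| * |Real.sign z| * Real.exp (-(|u| + |v|) ^ 2 / (2 * s))
      ≤ |beta a₁ a₂ ρ₁ ρ₂| * 1 * E := by gcongr
    linarith
  have hm : |(if z ≤ 0 then 1 / Real.sqrt a₁ else 0) + (if 0 < z then 1 / Real.sqrt a₂ else 0)|
      ≤ 1 / Real.sqrt a₁ + 1 / Real.sqrt a₂ := by
    have h1 : 0 ≤ 1 / Real.sqrt a₁ := by positivity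
    have h2 : 0 ≤ 1 / Real.sqrt a₂ := by positivity
    rw [abs_of_nonneg (by split_ifs <;> linarith)]
    split_ifs <;> linarith
  have hmm := pow_le_pow_left₀ (abs_nonneg _) hm 2
  have hbb := pow_le_pow_left₀ (abs_nonneg _) hb 2
  rw [sq_abs] at hmm hbb
  unfold G
  rw [mul_pow, mul_pow, inv_pow, Real.sq_sqrt (by positivity), auxM]
  calc _ ≤ (2 * π * s)⁻¹ * (1 / Real.sqrt a₁ + 1 / Real.sqrt a₂) ^ 2 *
        ((1 + |beta a₁ a₂ ρ₁ ρ₂|) * E) ^ 2 := by gcongr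
    _ = (2 * π * s)⁻¹ * ((1 / Real.sqrt a₁ + 1 / Real.sqrt a₂) ^ 2 *
        (1 + |beta a₁ a₂ ρ₁ ρ₂|) ^ 2) * E ^ 2 := by ring
    _ ≤ _ := by gcongr

lemma aux_inner (a₁ a₂ ρ₁ ρ₂ s x : ℝ) (ha₁ : 0 < a₁) (ha₂ : 0 < a₂) (hs : 0 < s) :
    ∫ z, (G a₁ a₂ ρ₁ ρ₂ s x z) ^ 2 ≤
      ((2 * π)⁻¹ * auxM a₁ a₂ ρ₁ ρ₂ * (Real.sqrt a₁ + Real.sqrt a₂) * Real.sqrt π)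
        * s ^ (-(1 / 2) : ℝ) := by
  obtain ⟨i1, e1⟩ := aux_gauss (Real.sqrt a₁) (f a₁ a₂ x) s (by positivity) hs
  obtain ⟨i2, e2⟩ := aux_gauss (Real.sqrt a₂) (f a₁ a₂ x) s (by positivity) hs
  refine (integral_mono_of_nonneg (Filter.Eventually.of_forall fun z => sq_nonneg _)
    ((i1.add i2).const_mul ((2 * π * s)⁻¹ * auxM a₁ a₂ ρ₁ ρ₂))
    (Filter.Eventually.of_forall fun z => aux_pt a₁ a₂ ρ₁ ρ₂ s x z hs)).trans ?_
  simp only [Pi.add_apply]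
  rw [integral_const_mul, integral_add i1 i2, e1, e2, Real.sqrt_mul pi_pos.le,
    Real.rpow_neg hs.le, ← Real.sqrt_eq_rpow]
  apply le_of_eq
  have h : Real.sqrt s ≠ 0 := by positivity
  have h2 : (2 * π * s)⁻¹ = (2 * π)⁻¹ * (Real.sqrt s)⁻¹ * (Real.sqrt s)⁻¹ := by
    rw [mul_assoc ((2 * π)⁻¹), ← mul_inv (Real.sqrt s), Real.mul_self_sqrt hs.le, mul_inv]
  rw [h2]
  field_simp

/-- Bound on `∫_{t(δ)}^{t+δ} ∫_ℝ G_{t+δ−r}(x,z)² dz dr` with `t(δ) = t − δ^{6/5}`. -/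
theorem stmt_9 (a₁ a₂ ρ₁ ρ₂ : ℝ) (ha₁ : 0 < a₁) (ha₂ : 0 < a₂)
    (hρ₁ : 0 < ρ₁) (hρ₂ : 0 < ρ₂) :
    ∃ C > 0, ∀ t x δ : ℝ, 0 < t → 0 < δ → δ ≤ 1 → δ ^ ((6 : ℝ) / 5) ≤ t →
      (∫ r in (t - δ ^ ((6 : ℝ) / 5))..(t + δ),
          ∫ z, (G a₁ a₂ ρ₁ ρ₂ (t + δ - r) x z) ^ 2) ≤ C * δ ^ ((1 : ℝ) / 2) ∧
      δ ^ ((3 : ℝ) / 5) *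
        (∫ r in (t - δ ^ ((6 : ℝ) / 5))..(t + δ),
          ∫ z, (G a₁ a₂ ρ₁ ρ₂ (t + δ - r) x z) ^ 2) ≤ C * δ ^ ((11 : ℝ) / 10) := by
  set K := (2 * π)⁻¹ * auxM a₁ a₂ ρ₁ ρ₂ * (Real.sqrt a₁ + Real.sqrt a₂) * Real.sqrt π with hK
  have hK0 : 0 < K := by
    rw [hK, auxM]
    positivity
  refine ⟨2 * Real.sqrt 2 * K, by positivity, ?_⟩
  intro t x δ ht hδ hδ1 hδt
  have key : (∫ r in (t - δ ^ ((6 : ℝ) / 5))..(t + δ),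
          ∫ z, (G a₁ a₂ ρ₁ ρ₂ (t + δ - r) x z) ^ 2)
          ≤ 2 * Real.sqrt 2 * K * δ ^ ((1 : ℝ) / 2) := by
    rw [intervalIntegral.integral_comp_sub_left
      (fun s => ∫ z, (G a₁ a₂ ρ₁ ρ₂ s x z) ^ 2) (t + δ)]
    rw [sub_self, show t + δ - (t - δ ^ ((6 : ℝ) / 5)) = δ + δ ^ ((6 : ℝ) / 5) by ring]
    set L := δ + δ ^ ((6 : ℝ) / 5) with hL
    have hp : 0 < δ ^ ((6 : ℝ) / 5) := by positivity
    have hL0 : 0 ≤ L := by positivity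
    have hL2 : L ≤ 2 * δ := by
      have : δ ^ ((6 : ℝ) / 5) ≤ δ ^ (1 : ℝ) :=
        Real.rpow_le_rpow_of_exponent_ge hδ hδ1 (by norm_num)
      rw [Real.rpow_one] at this
      linarith
    have hint : IntervalIntegrable (fun s : ℝ => K * s ^ (-(1 / 2) : ℝ)) volume 0 L :=
      (intervalIntegral.intervalIntegrable_rpow' (by norm_num)).const_mul K
    have hle : (∫ s in (0 : ℝ)..L, ∫ z, (G a₁ a₂ ρ₁ ρ₂ s x z) ^ 2)
        ≤ ∫ s in (0 : ℝ)..L, K * s ^ (-(1 / 2) : ℝ) := by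
      rw [intervalIntegral.integral_of_le hL0, intervalIntegral.integral_of_le hL0]
      refine integral_mono_of_nonneg
        (Filter.Eventually.of_forall fun s => integral_nonneg fun z => sq_nonneg _)
        ((intervalIntegrable_iff_integrableOn_Ioc_of_le hL0).mp hint) ?_
      filter_upwards [ae_restrict_mem measurableSet_Ioc] with s hs
      exact aux_inner a₁ a₂ ρ₁ ρ₂ s x ha₁ ha₂ hs.1
    refine hle.trans ?_
    rw [intervalIntegral.integral_const_mul, integral_rpow (Or.inl (by norm_num))]
    rw [show (-(1 / 2) + 1 : ℝ) = 1 / 2 by norm_num, Real.zero_rpow (by norm_num),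
      ← Real.sqrt_eq_rpow, ← Real.sqrt_eq_rpow]
    have : Real.sqrt L ≤ Real.sqrt 2 * Real.sqrt δ := by
      rw [← Real.sqrt_mul (by norm_num)]
      exact Real.sqrt_le_sqrt hL2
    have h3 := mul_le_mul_of_nonneg_left this hK0.le
    linarith
  refine ⟨key, ?_⟩
  have h := mul_le_mul_of_nonneg_left key (show 0 ≤ δ ^ ((3 : ℝ) / 5) by positivity)
  refine h.trans (le_of_eq ?_)
  rw [show (11 : ℝ) / 10 = 3 / 5 + 1 / 2 by norm_num, Real.rpow_add hδ]
  ring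
end

section
/- There exists a constant C > 0 depending only on a₁, a₂, ρ₁, ρ₂ such that for every t > 0, every x ∈ ℝ and every 0 < δ ≤ 1 with δ^{6/5} ≤ t, setting t(δ) = t − δ^{6/5}, one has ∫_{t(δ)}^{t+δ} ∫_ℝ G_{t+δ−r}(x, z)² · |x − z| dz dr ≤ C δ. -/
open Real MeasureTheory

lemma f_mono_aux (a₁ a₂ c : ℝ) (h1 : c ≤ 1 / Real.sqrt a₁) (h2 : c ≤ 1 / Real.sqrt a₂)
    (x y : ℝ) (hxy : x ≤ y) : c * (y - x) ≤ f a₁ a₂ y - f a₁ a₂ x := by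
  unfold f
  rw [one_div] at h1 h2
  simp only [div_eq_mul_inv]
  generalize (Real.sqrt a₁)⁻¹ = p at *
  generalize (Real.sqrt a₂)⁻¹ = q at *
  split_ifs with hy hx hx
  · nlinarith
  · linarith
  · nlinarith [mul_nonneg (sub_nonneg.2 h2) (not_le.1 hy).le,
      mul_nonneg (sub_nonneg.2 h1) (neg_nonneg.2 hx)]
  · nlinarith

lemma f_sq_aux (a₁ a₂ c : ℝ) (hc : 0 ≤ c) (h1 : c ≤ 1 / Real.sqrt a₁)
    (h2 : c ≤ 1 / Real.sqrt a₂) (x y : ℝ) :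
    c ^ 2 * (x - y) ^ 2 ≤ (f a₁ a₂ x - f a₁ a₂ y) ^ 2 := by
  rw [← mul_pow]
  rcases le_total x y with h | h
  · have := f_mono_aux a₁ a₂ c h1 h2 x y h
    have h3 : 0 ≤ c * (y - x) := mul_nonneg hc (by linarith)
    nlinarith
  · have := f_mono_aux a₁ a₂ c h1 h2 y x h
    have h3 : 0 ≤ c * (x - y) := mul_nonneg hc (by linarith)
    nlinarith

lemma G_bound (a₁ a₂ ρ₁ ρ₂ c s x z : ℝ) (hs : 0 < s) (hc : 0 ≤ c)
    (h1 : c ≤ 1 / Real.sqrt a₁) (h2 : c ≤ 1 / Real.sqrt a₂) :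
    |G a₁ a₂ ρ₁ ρ₂ s x z| ≤ (Real.sqrt (2 * Real.pi * s))⁻¹ *
      (1 / Real.sqrt a₁ + 1 / Real.sqrt a₂) *
      ((1 + |beta a₁ a₂ ρ₁ ρ₂|) * Real.exp (-(c ^ 2 * (x - z) ^ 2) / (2 * s))) := by
  have hp : 0 ≤ 1 / Real.sqrt a₁ := by positivity
  have hq : 0 ≤ 1 / Real.sqrt a₂ := by positivity
  have hf := f_sq_aux a₁ a₂ c hc h1 h2 x z
  have e1 : Real.exp (-(f a₁ a₂ x - f a₁ a₂ z) ^ 2 / (2 * s)) ≤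
      Real.exp (-(c ^ 2 * (x - z) ^ 2) / (2 * s)) := by
    gcongr
  have e2 : Real.exp (-(|f a₁ a₂ x| + |f a₁ a₂ z|) ^ 2 / (2 * s)) ≤
      Real.exp (-(c ^ 2 * (x - z) ^ 2) / (2 * s)) := by
    have : (f a₁ a₂ x - f a₁ a₂ z) ^ 2 ≤ (|f a₁ a₂ x| + |f a₁ a₂ z|) ^ 2 := by
      rw [← sq_abs (f a₁ a₂ x - f a₁ a₂ z)]
      have := abs_sub (f a₁ a₂ x) (f a₁ a₂ z)
      gcongr
    have := hf.trans this
    gcongr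
  have hsg : |Real.sign z| ≤ 1 := by
    rcases Real.sign_apply_eq z with h | h | h <;> simp [h]
  unfold G
  rw [abs_mul, abs_mul]
  refine mul_le_mul (mul_le_mul ?_ ?_ (abs_nonneg _) (by positivity)) ?_ (abs_nonneg _)
    (by positivity)
  · rw [abs_of_nonneg (by positivity)]
  · have : 0 ≤ (if z ≤ 0 then 1 / Real.sqrt a₁ else 0) := by split_ifs <;> positivity
    have : 0 ≤ (if 0 < z then 1 / Real.sqrt a₂ else 0) := by split_ifs <;> positivity
    rw [abs_of_nonneg (by positivity)]
    gcongr
    · split_ifs <;> linarith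
    · split_ifs <;> linarith
  · refine (abs_add_le _ _).trans ?_
    rw [abs_mul, abs_mul, abs_of_nonneg (Real.exp_pos _).le, abs_of_nonneg (Real.exp_pos _).le,
      add_mul, one_mul]
    refine add_le_add e1 (mul_le_mul ?_ e2 (Real.exp_pos _).le (abs_nonneg _))
    exact mul_le_of_le_one_right (abs_nonneg _) hsg

lemma abs_exp_bound (b u : ℝ) (hb : 0 < b) :
    Real.exp (-b * u ^ 2) * |u| ≤ (Real.sqrt b)⁻¹ * Real.exp (-(b / 2) * u ^ 2) := by
  have hsb : 0 < Real.sqrt b := Real.sqrt_pos.2 hb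
  have h : |u| * Real.sqrt b ≤ Real.exp (b / 2 * u ^ 2) := by
    have h1 := Real.add_one_le_exp (b / 2 * u ^ 2)
    have h2 : (|u| * Real.sqrt b) ^ 2 = b * u ^ 2 := by
      rw [mul_pow, sq_abs, Real.sq_sqrt hb.le, mul_comm]
    nlinarith [sq_nonneg (|u| * Real.sqrt b - 1)]
  have h3 : |u| ≤ (Real.sqrt b)⁻¹ * Real.exp (b / 2 * u ^ 2) := by
    rw [inv_mul_eq_div, le_div_iff₀ hsb]; exact h
  calc Real.exp (-b * u ^ 2) * |u|
      ≤ Real.exp (-b * u ^ 2) * ((Real.sqrt b)⁻¹ * Real.exp (b / 2 * u ^ 2)) := by gcongr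
    _ = (Real.sqrt b)⁻¹ * (Real.exp (-b * u ^ 2) * Real.exp (b / 2 * u ^ 2)) := by ring
    _ = _ := by rw [← Real.exp_add]; congr 2; ring

lemma inner_bound (a₁ a₂ ρ₁ ρ₂ c s x : ℝ) (hs : 0 < s) (hc : 0 < c)
    (h1 : c ≤ 1 / Real.sqrt a₁) (h2 : c ≤ 1 / Real.sqrt a₂) :
    ∫ z, (G a₁ a₂ ρ₁ ρ₂ s x z) ^ 2 * |x - z| ≤
      ((1 / Real.sqrt a₁ + 1 / Real.sqrt a₂) * (1 + |beta a₁ a₂ ρ₁ ρ₂|)) ^ 2 *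
        (2 * Real.pi)⁻¹ * Real.sqrt (2 * Real.pi) * (c ^ 2)⁻¹ := by
  set N := (1 / Real.sqrt a₁ + 1 / Real.sqrt a₂) * (1 + |beta a₁ a₂ ρ₁ ρ₂|) with hN
  set b := c ^ 2 / s with hb
  have hb0 : 0 < b := by positivity
  have key : ∀ z, (G a₁ a₂ ρ₁ ρ₂ s x z) ^ 2 * |x - z| ≤
      N ^ 2 * (2 * Real.pi * s)⁻¹ * (Real.sqrt b)⁻¹ * Real.exp (-(b / 2) * (x - z) ^ 2) := by
    intro z
    have hG := G_bound a₁ a₂ ρ₁ ρ₂ c s x z hs hc.le h1 h2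
    have hG2 := pow_le_pow_left₀ (abs_nonneg _) hG 2
    rw [sq_abs] at hG2
    have hps : 0 ≤ 2 * Real.pi * s := by positivity
    have e : ((Real.sqrt (2 * Real.pi * s))⁻¹ * (1 / Real.sqrt a₁ + 1 / Real.sqrt a₂) *
      ((1 + |beta a₁ a₂ ρ₁ ρ₂|) * Real.exp (-(c ^ 2 * (x - z) ^ 2) / (2 * s)))) ^ 2
      = N ^ 2 * (2 * Real.pi * s)⁻¹ * Real.exp (-b * (x - z) ^ 2) := by
      have e3 : Real.exp (-b * (x - z) ^ 2) =
          Real.exp (-(c ^ 2 * (x - z) ^ 2) / (2 * s)) ^ 2 := by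
        rw [← Real.exp_nat_mul]; congr 1; rw [hb]; push_cast; field_simp
      have e4 : (2 * Real.pi * s)⁻¹ = ((Real.sqrt (2 * Real.pi * s))⁻¹) ^ 2 := by
        rw [inv_pow, Real.sq_sqrt hps]
      rw [e3, e4, hN]; ring
    rw [e] at hG2
    calc _ ≤ N ^ 2 * (2 * Real.pi * s)⁻¹ * Real.exp (-b * (x - z) ^ 2) * |x - z| := by gcongr
      _ = N ^ 2 * (2 * Real.pi * s)⁻¹ * (Real.exp (-b * (x - z) ^ 2) * |x - z|) := by ring
      _ ≤ N ^ 2 * (2 * Real.pi * s)⁻¹ *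
          ((Real.sqrt b)⁻¹ * Real.exp (-(b / 2) * (x - z) ^ 2)) := by
        have := abs_exp_bound b (x - z) hb0
        gcongr
      _ = _ := by ring
  have hgauss : Integrable (fun z : ℝ => Real.exp (-(b / 2) * (x - z) ^ 2)) :=
    (integrable_exp_neg_mul_sq (half_pos hb0)).comp_sub_left x
  have hval : ∫ z : ℝ, Real.exp (-(b / 2) * (x - z) ^ 2) = Real.sqrt (Real.pi / (b / 2)) := by
    rw [integral_sub_left_eq_self (fun u : ℝ => Real.exp (-(b / 2) * u ^ 2)) volume x]
    exact integral_gaussian (b / 2)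
  refine (integral_mono_of_nonneg (Filter.Eventually.of_forall fun z => by positivity)
    (hgauss.const_mul _) (Filter.Eventually.of_forall key)).trans_eq ?_
  rw [integral_const_mul, hval]
  have e5 : Real.sqrt (Real.pi / (b / 2)) = Real.sqrt (2 * Real.pi) * (Real.sqrt b)⁻¹ := by
    rw [← Real.sqrt_inv, ← Real.sqrt_mul (by positivity)]; congr 1; field_simp
  have e6 : (Real.sqrt b)⁻¹ * (Real.sqrt b)⁻¹ = s / c ^ 2 := by
    rw [← mul_inv, Real.mul_self_sqrt hb0.le, hb, inv_div]
  calc _ = N ^ 2 * (2 * Real.pi * s)⁻¹ * Real.sqrt (2 * Real.pi) *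
        ((Real.sqrt b)⁻¹ * (Real.sqrt b)⁻¹) := by rw [e5]; ring
    _ = _ := by rw [e6]; field_simp

/-- Bound on `∫_{t(δ)}^{t+δ} ∫_ℝ G_{t+δ−r}(x,z)² |x−z| dz dr ≤ C δ`
with `t(δ) = t − δ^{6/5}`. -/
theorem stmt_10 (a₁ a₂ ρ₁ ρ₂ : ℝ) (ha₁ : 0 < a₁) (ha₂ : 0 < a₂)
    (hρ₁ : 0 < ρ₁) (hρ₂ : 0 < ρ₂) :
    ∃ C > 0, ∀ t x δ : ℝ, 0 < t → 0 < δ → δ ≤ 1 → δ ^ ((6 : ℝ) / 5) ≤ t →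
      (∫ r in (t - δ ^ ((6 : ℝ) / 5))..(t + δ),
          ∫ z, (G a₁ a₂ ρ₁ ρ₂ (t + δ - r) x z) ^ 2 * |x - z|) ≤ C * δ := by
  have hp : 0 < 1 / Real.sqrt a₁ := by positivity
  have hq : 0 < 1 / Real.sqrt a₂ := by positivity
  set c := min (1 / Real.sqrt a₁) (1 / Real.sqrt a₂) with hcdef
  have hc : 0 < c := lt_min hp hq
  set K := ((1 / Real.sqrt a₁ + 1 / Real.sqrt a₂) * (1 + |beta a₁ a₂ ρ₁ ρ₂|)) ^ 2 *
        (2 * Real.pi)⁻¹ * Real.sqrt (2 * Real.pi) * (c ^ 2)⁻¹ with hK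
  have hK0 : 0 < K := by positivity
  refine ⟨2 * K, by positivity, ?_⟩
  intro t x δ ht hδ hδ1 hδt
  have hpow : δ ^ ((6 : ℝ) / 5) ≤ δ := by
    have := Real.rpow_le_rpow_of_exponent_ge hδ hδ1 (show (1 : ℝ) ≤ 6 / 5 by norm_num)
    rwa [Real.rpow_one] at this
  have hpow0 : 0 ≤ δ ^ ((6 : ℝ) / 5) := Real.rpow_nonneg hδ.le _
  have hmain := intervalIntegral.norm_integral_le_of_norm_le_const
    (a := t - δ ^ ((6 : ℝ) / 5)) (b := t + δ) (C := K)
    (f := fun r => ∫ z, (G a₁ a₂ ρ₁ ρ₂ (t + δ - r) x z) ^ 2 * |x - z|) (by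
      intro r hr
      rw [Set.uIoc_of_le (by linarith)] at hr
      rw [Real.norm_of_nonneg (integral_nonneg fun z => by positivity)]
      rcases hr.2.lt_or_eq with h | h
      · exact inner_bound a₁ a₂ ρ₁ ρ₂ c _ x (by linarith) hc (min_le_left _ _) (min_le_right _ _)
      · have : ∀ z, G a₁ a₂ ρ₁ ρ₂ (t + δ - r) x z = 0 := by
          intro z; simp [G, h]
        simp only [this]
        simpa using hK0.le)
  refine (le_abs_self _).trans (hmain.trans ?_)
  rw [abs_of_nonneg (by linarith)]
  nlinarith
end

section
/- For every T > 0 and every x ∈ ℝ there exist constants C₁, C₂ > 0 such that for all 0 ≤ s ≤ t ≤ T, C₁ (t−s)^{1/2} ≤ ∫₀ᵗ ∫_ℝ (G_{t−r}(x, z) − 𝟙_{\{r < s\}} G_{s−r}(x, z))² dz dr ≤ C₂ (t−s)^{1/2}. (This double integral equals E|u(t,x) − u(s,x)|² for the mild solution u of the stochastic heat equation ∂_t u = 𝓛u + Ẇ with additive space-time white noise, so this is the temporal quasi-helix property of that solution.) -/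
open Real MeasureTheory

/-- Gaussian density. -/
noncomputable def pk (u w : ℝ) : ℝ := (√(2 * Real.pi * u))⁻¹ * Real.exp (-w ^ 2 / (2 * u))

/-- The piecewise constant weight. -/
noncomputable def wt (a₁ a₂ y : ℝ) : ℝ :=
  (if y ≤ 0 then 1 / Real.sqrt a₁ else 0) + (if 0 < y then 1 / Real.sqrt a₂ else 0)

/-- Closed form of the L2 distance of two Gaussian densities, up to a constant. -/
noncomputable def Dk (u v : ℝ) : ℝ := (√u)⁻¹ + (√v)⁻¹ - 2 * (√((u + v) / 2))⁻¹

lemma G_eq (a₁ a₂ ρ₁ ρ₂ t x y : ℝ) : G a₁ a₂ ρ₁ ρ₂ t x y =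
    wt a₁ a₂ y * (pk t (f a₁ a₂ x - f a₁ a₂ y) +
      beta a₁ a₂ ρ₁ ρ₂ * Real.sign y * pk t (|f a₁ a₂ x| + |f a₁ a₂ y|)) := by
  unfold G wt pk; ring

lemma abs_beta_lt (a₁ a₂ ρ₁ ρ₂ : ℝ) (ha₁ : 0 < a₁) (ha₂ : 0 < a₂)
    (hρ₁ : 0 < ρ₁) (hρ₂ : 0 < ρ₂) : |beta a₁ a₂ ρ₁ ρ₂| < 1 := by
  unfold beta
  have h1 : 0 < √a₁ := Real.sqrt_pos.2 ha₁
  have h2 : 0 < √a₂ * (ρ₁ * a₁ / (ρ₂ * a₂)) := by positivity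
  have e : √a₂ * ((1 - ρ₁ * a₁ / (ρ₂ * a₂)) - 1) = - (√a₂ * (ρ₁ * a₁ / (ρ₂ * a₂))) := by ring
  rw [e]
  generalize √a₂ * (ρ₁ * a₁ / (ρ₂ * a₂)) = q at *
  rw [abs_div, div_lt_one (by rw [abs_pos]; linarith), abs_of_pos (by linarith : 0 < √a₁ - -q), abs_lt]
  constructor <;> linarith

lemma f_lin (a₁ a₂ y : ℝ) : f a₁ a₂ y = wt a₁ a₂ y * y := by
  unfold f wt
  rcases le_or_gt y 0 with h | h
  · simp [h, not_lt.2 h]; ring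
  · simp [h, not_le.2 h]; ring

lemma wt_cases (a₁ a₂ y : ℝ) : wt a₁ a₂ y = 1 / √a₁ ∨ wt a₁ a₂ y = 1 / √a₂ := by
  unfold wt
  rcases le_or_gt y 0 with h | h
  · simp [h, not_lt.2 h]
  · simp [h, not_le.2 h]

lemma wt_le (a₁ a₂ y : ℝ) : wt a₁ a₂ y ≤ max (1 / √a₁) (1 / √a₂) := by
  rcases wt_cases a₁ a₂ y with h | h <;> rw [h] <;> simp

lemma le_wt (a₁ a₂ y : ℝ) : min (1 / √a₁) (1 / √a₂) ≤ wt a₁ a₂ y := by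
  rcases wt_cases a₁ a₂ y with h | h <;> rw [h] <;> simp

lemma f_mono_bounds (a₁ a₂ : ℝ) {x y : ℝ} (h : x ≤ y) :
    min (1 / √a₁) (1 / √a₂) * (y - x) ≤ f a₁ a₂ y - f a₁ a₂ x ∧
    f a₁ a₂ y - f a₁ a₂ x ≤ max (1 / √a₁) (1 / √a₂) * (y - x) := by
  have e : ∀ z, f a₁ a₂ z = if z ≤ 0 then 1 / √a₁ * z else 1 / √a₂ * z := by
    intro z; unfold f; split_ifs <;> ring
  rw [e, e]
  generalize 1 / √a₁ = k₁
  generalize 1 / √a₂ = k₂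
  have m1 := min_le_left k₁ k₂
  have m2 := min_le_right k₁ k₂
  have M1 := le_max_left k₁ k₂
  have M2 := le_max_right k₁ k₂
  generalize min k₁ k₂ = m at *
  generalize max k₁ k₂ = M at *
  split_ifs <;> constructor <;> nlinarith

lemma f_sq_bounds (a₁ a₂ : ℝ) (ha₁ : 0 < a₁) (ha₂ : 0 < a₂) (x y : ℝ) :
    (min (1 / √a₁) (1 / √a₂)) ^ 2 * (x - y) ^ 2 ≤ (f a₁ a₂ x - f a₁ a₂ y) ^ 2 ∧
    (f a₁ a₂ x - f a₁ a₂ y) ^ 2 ≤ (max (1 / √a₁) (1 / √a₂)) ^ 2 * (x - y) ^ 2 := by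
  have hm : 0 ≤ min (1 / √a₁) (1 / √a₂) := by positivity
  rcases le_total x y with h | h
  · obtain ⟨h1, h2⟩ := f_mono_bounds a₁ a₂ h
    have h0 : 0 ≤ min (1 / √a₁) (1 / √a₂) * (y - x) := mul_nonneg hm (by linarith)
    constructor
    · have := pow_le_pow_left₀ h0 h1 2; linarith
    · have := pow_le_pow_left₀ (h0.trans h1) h2 2; linarith
  · obtain ⟨h1, h2⟩ := f_mono_bounds a₁ a₂ h
    have h0 : 0 ≤ min (1 / √a₁) (1 / √a₂) * (x - y) := mul_nonneg hm (by linarith)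
    constructor
    · have := pow_le_pow_left₀ h0 h1 2; linarith
    · have := pow_le_pow_left₀ (h0.trans h1) h2 2; linarith

lemma int_aff (g : ℝ → ℝ) (c k : ℝ) : ∫ y, g (c + k * y) = |k⁻¹| * ∫ w, g w := by
  rw [Measure.integral_comp_mul_left (fun z => g (c + z)) k, integral_add_left_eq_self]
  simp

lemma integrable_aff {g : ℝ → ℝ} (hg : Integrable g) (c : ℝ) {k : ℝ} (hk : k ≠ 0) :
    Integrable (fun y => g (c + k * y)) :=
  (hg.comp_add_left c).comp_mul_left' hk

lemma pk_nonneg (u w : ℝ) : 0 ≤ pk u w := by unfold pk; positivity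

lemma pk_anti {u w w' : ℝ} (hu : 0 < u) (h : w ^ 2 ≤ w' ^ 2) : pk u w' ≤ pk u w := by
  unfold pk; gcongr

lemma pk_sq (u w : ℝ) (hu : 0 < u) : pk u w ^ 2 = (2 * π * u)⁻¹ * Real.exp (-(1 / u) * w ^ 2) := by
  unfold pk
  rw [mul_pow, inv_pow, Real.sq_sqrt (by positivity), ← Real.exp_nat_mul]
  congr 2; push_cast; field_simp

lemma pk_mul (u v w : ℝ) (hu : 0 < u) (hv : 0 < v) : pk u w * pk v w =
    (2 * π * (√u * √v))⁻¹ * Real.exp (-((u + v) / (2 * u * v)) * w ^ 2) := by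
  unfold pk
  rw [mul_mul_mul_comm, ← Real.exp_add, ← mul_inv, Real.sqrt_mul (by positivity) u,
    Real.sqrt_mul (by positivity) v]
  congr 2
  · have := Real.mul_self_sqrt (show 0 ≤ 2 * π by positivity)
    linear_combination (√u * √v) * this
  · field_simp; ring

lemma integrable_pk_sq (u : ℝ) (hu : 0 < u) : Integrable (fun w => pk u w ^ 2) := by
  simp_rw [pk_sq u _ hu]
  exact (integrable_exp_neg_mul_sq (by positivity)).const_mul _

lemma integral_pk_sq (u : ℝ) (hu : 0 < u) : ∫ w, pk u w ^ 2 = (2 * √π)⁻¹ * (√u)⁻¹ := by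
  simp_rw [pk_sq u _ hu]
  rw [integral_const_mul, integral_gaussian, div_div_eq_mul_div, div_one,
    Real.sqrt_mul (by positivity)]
  have h1 := Real.mul_self_sqrt pi_pos.le
  have h2 := Real.mul_self_sqrt hu.le
  have : 0 < √π := Real.sqrt_pos.2 pi_pos
  have : 0 < √u := Real.sqrt_pos.2 hu
  field_simp
  nlinarith

lemma integrable_pk_mul (u v : ℝ) (hu : 0 < u) (hv : 0 < v) :
    Integrable (fun w => pk u w * pk v w) := by
  simp_rw [pk_mul u v _ hu hv]
  exact (integrable_exp_neg_mul_sq (by positivity)).const_mul _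

lemma integral_pk_mul (u v : ℝ) (hu : 0 < u) (hv : 0 < v) :
    ∫ w, pk u w * pk v w = (2 * √π)⁻¹ * (√((u + v) / 2))⁻¹ := by
  simp_rw [pk_mul u v _ hu hv]
  rw [integral_const_mul, integral_gaussian]
  have e : π / ((u + v) / (2 * u * v)) = π * (u * v) / ((u + v) / 2) := by field_simp
  rw [e, Real.sqrt_div (by positivity), Real.sqrt_mul (by positivity), Real.sqrt_mul hu.le]
  have h1 := Real.mul_self_sqrt pi_pos.le
  have : 0 < √π := Real.sqrt_pos.2 pi_pos
  have : 0 < √u := Real.sqrt_pos.2 hu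
  have : 0 < √v := Real.sqrt_pos.2 hv
  have : 0 < √((u + v) / 2) := Real.sqrt_pos.2 (by positivity)
  generalize √((u + v) / 2) = q at *
  field_simp
  nlinarith

/-- squared difference of Gaussians -/
noncomputable def qk (u v w : ℝ) : ℝ := (pk u w - pk v w) ^ 2

lemma qk_eq (u v : ℝ) : qk u v = fun w => pk u w ^ 2 + pk v w ^ 2 - 2 * (pk u w * pk v w) := by
  ext w; unfold qk; ring

lemma integrable_qk (u v : ℝ) (hu : 0 < u) (hv : 0 < v) : Integrable (qk u v) := by
  rw [qk_eq]
  exact ((integrable_pk_sq u hu).add (integrable_pk_sq v hv)).sub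
    ((integrable_pk_mul u v hu hv).const_mul 2)

lemma integral_qk (u v : ℝ) (hu : 0 < u) (hv : 0 < v) :
    ∫ w, qk u v w = (2 * √π)⁻¹ * Dk u v := by
  have i1 : Integrable (fun w => pk u w ^ 2 + pk v w ^ 2) :=
    (integrable_pk_sq u hu).add (integrable_pk_sq v hv)
  have i2 : Integrable (fun w => 2 * (pk u w * pk v w)) :=
    (integrable_pk_mul u v hu hv).const_mul 2
  rw [qk_eq, integral_sub i1 i2, integral_add (integrable_pk_sq u hu)
    (integrable_pk_sq v hv), integral_const_mul, integral_pk_sq u hu, integral_pk_sq v hv,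
    integral_pk_mul u v hu hv]
  unfold Dk; ring

lemma qk_nonneg (u v w : ℝ) : 0 ≤ qk u v w := sq_nonneg _

lemma qk_neg (u v w : ℝ) : qk u v (-w) = qk u v w := by unfold qk pk; simp

lemma abs_sign_le (y : ℝ) : |Real.sign y| ≤ 1 := by
  rcases Real.sign_apply_eq y with h | h | h <;> rw [h] <;> simp

/-- majorant of the squared kernel difference -/
noncomputable def maj (k₁ k₂ c d u v y : ℝ) : ℝ :=
  qk u v (c + (-k₁) * y) + qk u v (c + (-k₂) * y) + qk u v (d + k₁ * y) + qk u v (d + k₂ * y)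
    + qk u v (d + (-k₁) * y) + qk u v (d + (-k₂) * y)

lemma integrable_maj (k₁ k₂ c d u v : ℝ) (h₁ : 0 < k₁) (h₂ : 0 < k₂) (hu : 0 < u) (hv : 0 < v) :
    Integrable (maj k₁ k₂ c d u v) := by
  have hq := integrable_qk u v hu hv
  have n1 : -k₁ ≠ 0 := neg_ne_zero.2 h₁.ne'
  have n2 : -k₂ ≠ 0 := neg_ne_zero.2 h₂.ne'
  exact (((((integrable_aff hq c n1).add (integrable_aff hq c n2)).add
    (integrable_aff hq d h₁.ne')).add (integrable_aff hq d h₂.ne')).add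
    (integrable_aff hq d n1)).add (integrable_aff hq d n2)

lemma integral_maj (k₁ k₂ c d u v : ℝ) (h₁ : 0 < k₁) (h₂ : 0 < k₂) (hu : 0 < u) (hv : 0 < v) :
    ∫ y, maj k₁ k₂ c d u v y = (3 * (k₁⁻¹ + k₂⁻¹)) * ((2 * √π)⁻¹ * Dk u v) := by
  have hq := integrable_qk u v hu hv
  have n1 : -k₁ ≠ 0 := neg_ne_zero.2 h₁.ne'
  have n2 : -k₂ ≠ 0 := neg_ne_zero.2 h₂.ne'
  have i1 := integrable_aff hq c n1
  have i2 := integrable_aff hq c n2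
  have i3 := integrable_aff hq d h₁.ne'
  have i4 := integrable_aff hq d h₂.ne'
  have i5 := integrable_aff hq d n1
  have i6 := integrable_aff hq d n2
  unfold maj
  rw [integral_add (by fun_prop) i6, integral_add (by fun_prop) i5,
    integral_add (by fun_prop) i4, integral_add (by fun_prop) i3, integral_add i1 i2]
  simp only [int_aff, integral_qk u v hu hv, inv_neg, abs_neg, abs_inv, abs_of_pos h₁, abs_of_pos h₂]
  ring

lemma diff_le (a₁ a₂ ρ₁ ρ₂ : ℝ) (ha₁ : 0 < a₁) (ha₂ : 0 < a₂)
    (hρ₁ : 0 < ρ₁) (hρ₂ : 0 < ρ₂) (u v x y : ℝ) :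
    (G a₁ a₂ ρ₁ ρ₂ u x y - G a₁ a₂ ρ₁ ρ₂ v x y) ^ 2 ≤
      2 * (max (1 / √a₁) (1 / √a₂)) ^ 2 *
        maj (1 / √a₁) (1 / √a₂) (f a₁ a₂ x) |f a₁ a₂ x| u v y := by
  rw [G_eq, G_eq]
  have hb := abs_beta_lt a₁ a₂ ρ₁ ρ₂ ha₁ ha₂ hρ₁ hρ₂
  set M := max (1 / √a₁) (1 / √a₂)
  have hw : wt a₁ a₂ y ^ 2 ≤ M ^ 2 := by
    apply pow_le_pow_left₀ _ (wt_le a₁ a₂ y)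
    exact le_trans (by positivity) (le_wt a₁ a₂ y)
  have hbs : (beta a₁ a₂ ρ₁ ρ₂ * Real.sign y) ^ 2 ≤ 1 := by
    rw [sq_le_one_iff_abs_le_one, abs_mul]
    exact mul_le_one₀ hb.le (abs_nonneg _) (abs_sign_le y)
  have key : qk u v (f a₁ a₂ x - f a₁ a₂ y) + qk u v (|f a₁ a₂ x| + |f a₁ a₂ y|) ≤
      maj (1 / √a₁) (1 / √a₂) (f a₁ a₂ x) |f a₁ a₂ x| u v y := by
    have hw0 : 0 ≤ wt a₁ a₂ y := le_trans (by positivity) (le_wt a₁ a₂ y)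
    rw [f_lin a₁ a₂ y, abs_mul, abs_of_nonneg hw0]
    generalize f a₁ a₂ x = c
    unfold maj
    have P := qk_nonneg u v
    have P1 := P (c + -(1 / √a₁) * y)
    have P2 := P (c + -(1 / √a₂) * y)
    have P3 := P (|c| + (1 / √a₁) * y)
    have P4 := P (|c| + (1 / √a₂) * y)
    have P5 := P (|c| + -(1 / √a₁) * y)
    have P6 := P (|c| + -(1 / √a₂) * y)
    rcases wt_cases a₁ a₂ y with h | h <;> rw [h, sub_eq_add_neg, ← neg_mul] <;>
      rcases abs_choice y with h' | h' <;> rw [h'] <;>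
      simp only [mul_neg, neg_mul] at * <;> linarith
  have hM : 0 ≤ 2 * M ^ 2 := by positivity
  refine le_trans ?_ (mul_le_mul_of_nonneg_left key hM)
  unfold qk
  generalize beta a₁ a₂ ρ₁ ρ₂ * Real.sign y = b at *
  generalize wt a₁ a₂ y = w at *
  generalize pk u (f a₁ a₂ x - f a₁ a₂ y) = p1
  generalize pk v (f a₁ a₂ x - f a₁ a₂ y) = p2
  generalize pk u (|f a₁ a₂ x| + |f a₁ a₂ y|) = p3
  generalize pk v (|f a₁ a₂ x| + |f a₁ a₂ y|) = p4
  calc _ = w ^ 2 * ((p1 - p2) + b * (p3 - p4)) ^ 2 := by ring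
    _ ≤ M ^ 2 * (2 * ((p1 - p2) ^ 2 + (p3 - p4) ^ 2)) := by
      apply mul_le_mul hw _ (sq_nonneg _) (sq_nonneg _)
      nlinarith [sq_nonneg ((p1 - p2) - b * (p3 - p4)),
        mul_le_mul_of_nonneg_right hbs (sq_nonneg (p3 - p4))]
    _ = _ := by ring

lemma G_sq_bounds (a₁ a₂ ρ₁ ρ₂ : ℝ) (ha₁ : 0 < a₁) (ha₂ : 0 < a₂)
    (hρ₁ : 0 < ρ₁) (hρ₂ : 0 < ρ₂) (u x y : ℝ) (hu : 0 < u) :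
    (min (1 / √a₁) (1 / √a₂) * (1 - |beta a₁ a₂ ρ₁ ρ₂|)) ^ 2 *
      pk u (max (1 / √a₁) (1 / √a₂) * x + (-max (1 / √a₁) (1 / √a₂)) * y) ^ 2
      ≤ G a₁ a₂ ρ₁ ρ₂ u x y ^ 2 ∧
    G a₁ a₂ ρ₁ ρ₂ u x y ^ 2 ≤ (max (1 / √a₁) (1 / √a₂) * 2) ^ 2 *
      pk u (min (1 / √a₁) (1 / √a₂) * x + (-min (1 / √a₁) (1 / √a₂)) * y) ^ 2 := by
  rw [G_eq]
  have hb := abs_beta_lt a₁ a₂ ρ₁ ρ₂ ha₁ ha₂ hρ₁ hρ₂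
  have hm : 0 < min (1 / √a₁) (1 / √a₂) := by positivity
  obtain ⟨f1, f2⟩ := f_sq_bounds a₁ a₂ ha₁ ha₂ x y
  have w1 := le_wt a₁ a₂ y
  have w2 := wt_le a₁ a₂ y
  set M := max (1 / √a₁) (1 / √a₂)
  set m := min (1 / √a₁) (1 / √a₂)
  have q1 : pk u (M * x + (-M) * y) ≤ pk u (f a₁ a₂ x - f a₁ a₂ y) :=
    pk_anti hu (by nlinarith)
  have q2 : pk u (f a₁ a₂ x - f a₁ a₂ y) ≤ pk u (m * x + (-m) * y) :=
    pk_anti hu (by nlinarith)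
  have q3 : pk u (|f a₁ a₂ x| + |f a₁ a₂ y|) ≤ pk u (f a₁ a₂ x - f a₁ a₂ y) := by
    apply pk_anti hu
    rw [sq_le_sq, abs_of_nonneg (by positivity : 0 ≤ |f a₁ a₂ x| + |f a₁ a₂ y|)]
    exact abs_sub _ _
  have n1 := pk_nonneg u (M * x + (-M) * y)
  have n3 := pk_nonneg u (|f a₁ a₂ x| + |f a₁ a₂ y|)
  have hbs : |beta a₁ a₂ ρ₁ ρ₂ * Real.sign y| ≤ |beta a₁ a₂ ρ₁ ρ₂| := by
    rw [abs_mul]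
    exact mul_le_of_le_one_right (abs_nonneg _) (abs_sign_le y)
  have hb0 := abs_nonneg (beta a₁ a₂ ρ₁ ρ₂)
  generalize beta a₁ a₂ ρ₁ ρ₂ * Real.sign y = b at *
  generalize |beta a₁ a₂ ρ₁ ρ₂| = B at *
  generalize wt a₁ a₂ y = w at *
  generalize pk u (f a₁ a₂ x - f a₁ a₂ y) = p1 at *
  generalize pk u (|f a₁ a₂ x| + |f a₁ a₂ y|) = p3 at *
  generalize pk u (M * x + (-M) * y) = pM at *
  generalize pk u (m * x + (-m) * y) = pm at *
  obtain ⟨b1, b2⟩ := abs_le.1 hbs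
  have l1 : (1 - B) * pM ≤ p1 + b * p3 := by nlinarith
  have l2 : p1 + b * p3 ≤ 2 * pm := by nlinarith
  have l0 : 0 ≤ (1 - B) * pM := mul_nonneg (by linarith) n1
  rw [← mul_pow, ← mul_pow]
  constructor
  · apply pow_le_pow_left₀
    · rw [mul_assoc]; positivity
    · rw [mul_assoc]
      exact mul_le_mul w1 l1 l0 (hm.le.trans w1)
  · apply pow_le_pow_left₀
    · exact mul_nonneg (hm.le.trans w1) (l0.trans l1)
    · rw [mul_assoc]
      exact mul_le_mul w2 l2 (l0.trans l1) ((hm.le.trans w1).trans w2)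

lemma measurable_wt (a₁ a₂ : ℝ) : Measurable (wt a₁ a₂) := by
  unfold wt
  exact (Measurable.ite measurableSet_Iic measurable_const measurable_const).add
    (Measurable.ite measurableSet_Ioi measurable_const measurable_const)

lemma measurable_f (a₁ a₂ : ℝ) : Measurable (f a₁ a₂) := by
  unfold f
  exact Measurable.ite measurableSet_Iic (by fun_prop) (by fun_prop)

lemma measurable_sign' : Measurable Real.sign := by
  unfold Real.sign
  exact Measurable.ite measurableSet_Iio measurable_const
    (Measurable.ite measurableSet_Ioi measurable_const measurable_const)

lemma measurable_G (a₁ a₂ ρ₁ ρ₂ x : ℝ) :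
    Measurable (fun p : ℝ × ℝ => G a₁ a₂ ρ₁ ρ₂ p.1 x p.2) := by
  simp_rw [G_eq]
  unfold pk
  have h1 := measurable_wt a₁ a₂
  have h2 := measurable_f a₁ a₂
  have h3 := measurable_sign'
  have h4 : Measurable (fun y => |f a₁ a₂ y|) := h2.abs
  have h5 : Measurable (fun p : ℝ × ℝ => |f a₁ a₂ p.2|) := h4.comp measurable_snd
  fun_prop

lemma measurable_int (a₁ a₂ ρ₁ ρ₂ x s t : ℝ) : StronglyMeasurable (fun r => ∫ z,
          (G a₁ a₂ ρ₁ ρ₂ (t - r) x z -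
            (if r < s then G a₁ a₂ ρ₁ ρ₂ (s - r) x z else 0)) ^ 2) := by
  have hm : Measurable (fun p : ℝ × ℝ => (G a₁ a₂ ρ₁ ρ₂ (t - p.1) x p.2 -
            (if p.1 < s then G a₁ a₂ ρ₁ ρ₂ (s - p.1) x p.2 else 0)) ^ 2) := by
    have h := measurable_G a₁ a₂ ρ₁ ρ₂ x
    have h1 : ∀ c : ℝ, Measurable (fun p : ℝ × ℝ => G a₁ a₂ ρ₁ ρ₂ (c - p.1) x p.2) := fun c =>
      h.comp (g := fun p : ℝ × ℝ => G a₁ a₂ ρ₁ ρ₂ p.1 x p.2) (f := fun p : ℝ × ℝ => (c - p.1, p.2))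
        (by fun_prop)
    exact ((h1 t).sub (Measurable.ite (measurableSet_lt measurable_fst measurable_const)
      (h1 s) measurable_const)).pow_const 2
  exact hm.stronglyMeasurable.integral_prod_right (ν := volume)

lemma inv_sqrt_eq (y : ℝ) (hy : 0 ≤ y) : (√y)⁻¹ = y ^ (-(1 / 2) : ℝ) := by
  rw [Real.sqrt_eq_rpow, Real.rpow_neg hy]

lemma ii_inv_sqrt (a b c : ℝ) (hac : a ≤ c) (hbc : b ≤ c) :
    IntervalIntegrable (fun r => (√(c - r))⁻¹) volume a b := by
  have h : IntervalIntegrable (fun y : ℝ => y ^ (-(1 / 2) : ℝ)) volume (c - a) (c - b) :=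
    intervalIntegral.intervalIntegrable_rpow' (by norm_num)
  have h2 := h.comp_sub_left c
  simp only [sub_sub_cancel] at h2
  refine h2.congr ?_
  intro r hr
  have : r ≤ c := by
    rcases Set.mem_uIoc.1 hr with h | h <;> linarith [h.2]
  exact (inv_sqrt_eq _ (by linarith)).symm

lemma int_inv_sqrt (a b c : ℝ) (hac : a ≤ c) (hbc : b ≤ c) :
    ∫ r in a..b, (√(c - r))⁻¹ = 2 * (√(c - a) - √(c - b)) := by
  rw [intervalIntegral.integral_comp_sub_left (fun y => (√y)⁻¹) c]
  have : ∫ y in (c - b)..(c - a), (√y)⁻¹ = ∫ y in (c - b)..(c - a), y ^ (-(1 / 2) : ℝ) := by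
    apply intervalIntegral.integral_congr
    intro y hy
    have : 0 ≤ y := by
      rcases Set.mem_uIcc.1 hy with h | h <;> linarith [h.1]
    exact inv_sqrt_eq _ this
  rw [this, integral_rpow (Or.inl (by norm_num)), Real.sqrt_eq_rpow, Real.sqrt_eq_rpow]
  norm_num
  ring

/-- Temporal quasi-helix property: the variance of the temporal increment of the
mild solution (with additive noise), expressed through the kernel `G`, is
comparable to `(t−s)^{1/2}`. -/
theorem stmt_12 (a₁ a₂ ρ₁ ρ₂ : ℝ) (ha₁ : 0 < a₁) (ha₂ : 0 < a₂)
    (hρ₁ : 0 < ρ₁) (hρ₂ : 0 < ρ₂) (T : ℝ) (hT : 0 < T) (x : ℝ) :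
    ∃ C₁ > 0, ∃ C₂ > 0, ∀ s t : ℝ, 0 ≤ s → s ≤ t → t ≤ T →
      C₁ * (t - s) ^ ((1 : ℝ) / 2) ≤
        (∫ r in (0 : ℝ)..t, ∫ z,
          (G a₁ a₂ ρ₁ ρ₂ (t - r) x z -
            (if r < s then G a₁ a₂ ρ₁ ρ₂ (s - r) x z else 0)) ^ 2) ∧
      (∫ r in (0 : ℝ)..t, ∫ z,
          (G a₁ a₂ ρ₁ ρ₂ (t - r) x z -
            (if r < s then G a₁ a₂ ρ₁ ρ₂ (s - r) x z else 0)) ^ 2) ≤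
        C₂ * (t - s) ^ ((1 : ℝ) / 2) := by
  set k₁ := 1 / √a₁ with hk₁
  set k₂ := 1 / √a₂ with hk₂
  have k₁p : 0 < k₁ := by positivity
  have k₂p : 0 < k₂ := by positivity
  set M := max k₁ k₂ with hM
  set m := min k₁ k₂ with hm
  have Mp : 0 < M := by positivity
  have mp : 0 < m := by positivity
  have hb := abs_beta_lt a₁ a₂ ρ₁ ρ₂ ha₁ ha₂ hρ₁ hρ₂
  have bp : 0 < 1 - |beta a₁ a₂ ρ₁ ρ₂| := by linarith
  have sp : 0 < √π := Real.sqrt_pos.2 pi_pos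
  set A := (m * (1 - |beta a₁ a₂ ρ₁ ρ₂|)) ^ 2 * (M⁻¹ * (2 * √π)⁻¹) with hA
  set B := (M * 2) ^ 2 * (m⁻¹ * (2 * √π)⁻¹) with hB
  set E := 2 * M ^ 2 * (3 * (k₁⁻¹ + k₂⁻¹)) * (2 * √π)⁻¹ with hE
  have Ap : 0 < A := by positivity
  have Bp : 0 < B := by positivity
  have Ep : 0 < E := by positivity
  have mG : ∀ u, Measurable (fun y => G a₁ a₂ ρ₁ ρ₂ u x y) := fun u =>
    (measurable_G a₁ a₂ ρ₁ ρ₂ x).comp (measurable_const.prodMk measurable_id)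
  have up : ∀ u, 0 < u → ∫ y, G a₁ a₂ ρ₁ ρ₂ u x y ^ 2 ≤ B * (√u)⁻¹ := by
    intro u hu
    have i1 := integrable_aff (integrable_pk_sq u hu) (m * x) (k := -m) (neg_ne_zero.2 mp.ne')
    calc _ ≤ ∫ y, (M * 2) ^ 2 * pk u (m * x + -m * y) ^ 2 := by
          apply integral_mono_of_nonneg (Filter.Eventually.of_forall fun _ => sq_nonneg _)
            (i1.const_mul _)
          exact Filter.Eventually.of_forall fun y =>
            (G_sq_bounds a₁ a₂ ρ₁ ρ₂ ha₁ ha₂ hρ₁ hρ₂ u x y hu).2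
      _ = _ := by
          rw [integral_const_mul, int_aff (fun w => pk u w ^ 2), integral_pk_sq u hu, inv_neg,
            abs_neg, abs_inv, abs_of_pos mp]
          ring
  have lo : ∀ u, 0 < u → A * (√u)⁻¹ ≤ ∫ y, G a₁ a₂ ρ₁ ρ₂ u x y ^ 2 := by
    intro u hu
    have i1 := integrable_aff (integrable_pk_sq u hu) (m * x) (k := -m) (neg_ne_zero.2 mp.ne')
    have iG : Integrable (fun y => G a₁ a₂ ρ₁ ρ₂ u x y ^ 2) := by
      refine (i1.const_mul ((M * 2) ^ 2)).mono' ((mG u).pow_const 2).aestronglyMeasurable ?_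
      refine Filter.Eventually.of_forall fun y => ?_
      rw [Real.norm_of_nonneg (sq_nonneg _)]
      exact (G_sq_bounds a₁ a₂ ρ₁ ρ₂ ha₁ ha₂ hρ₁ hρ₂ u x y hu).2
    calc _ = ∫ y, (m * (1 - |beta a₁ a₂ ρ₁ ρ₂|)) ^ 2 * pk u (M * x + -M * y) ^ 2 := by
          rw [integral_const_mul, int_aff (fun w => pk u w ^ 2), integral_pk_sq u hu, inv_neg,
            abs_neg, abs_inv, abs_of_pos Mp]
          ring
      _ ≤ _ := by
          apply integral_mono_of_nonneg
            (Filter.Eventually.of_forall fun _ => by positivity) iG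
          exact Filter.Eventually.of_forall fun y =>
            (G_sq_bounds a₁ a₂ ρ₁ ρ₂ ha₁ ha₂ hρ₁ hρ₂ u x y hu).1
  have df : ∀ u v, 0 < u → 0 < v →
      ∫ y, (G a₁ a₂ ρ₁ ρ₂ u x y - G a₁ a₂ ρ₁ ρ₂ v x y) ^ 2 ≤ E * Dk u v := by
    intro u v hu hv
    calc _ ≤ ∫ y, 2 * M ^ 2 * maj k₁ k₂ (f a₁ a₂ x) |f a₁ a₂ x| u v y := by
          apply integral_mono_of_nonneg (Filter.Eventually.of_forall fun _ => sq_nonneg _)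
            ((integrable_maj k₁ k₂ _ _ u v k₁p k₂p hu hv).const_mul _)
          exact Filter.Eventually.of_forall fun y =>
            diff_le a₁ a₂ ρ₁ ρ₂ ha₁ ha₂ hρ₁ hρ₂ u v x y
      _ = _ := by
          rw [integral_const_mul, integral_maj _ _ _ _ _ _ k₁p k₂p hu hv]
          ring
  clear_value A B E
  refine ⟨2 * A, by positivity, 4 * E + 2 * B, by positivity, ?_⟩
  intro s t hs hst htT
  have hmeas := measurable_int a₁ a₂ ρ₁ ρ₂ x s t
  set H : ℝ → ℝ := fun r => ∫ z, (G a₁ a₂ ρ₁ ρ₂ (t - r) x z -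
            (if r < s then G a₁ a₂ ρ₁ ρ₂ (s - r) x z else 0)) ^ 2 with hH
  have H0 : ∀ r, 0 ≤ H r := fun r => integral_nonneg fun z => sq_nonneg _
  have H1 : ∀ r, r < s → H r ≤ E * Dk (t - r) (s - r) := by
    intro r hr
    simp only [hH, if_pos hr]
    exact df _ _ (by linarith) (by linarith)
  have H2 : ∀ r, s ≤ r → H r = ∫ z, G a₁ a₂ ρ₁ ρ₂ (t - r) x z ^ 2 := by
    intro r hr
    simp only [hH, if_neg (not_lt.2 hr), sub_zero]
  have hD : ∀ r, Dk (t - r) (s - r) =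
      (√(t - r))⁻¹ + (√(s - r))⁻¹ - 2 * (√((t + s) / 2 - r))⁻¹ := by
    intro r; unfold Dk; congr 5; ring
  have j1 := ii_inv_sqrt 0 s t (by linarith) hst
  have j2 := ii_inv_sqrt 0 s s hs le_rfl
  have j3 := ii_inv_sqrt 0 s ((t + s) / 2) (by linarith) (by linarith)
  have j4 := ii_inv_sqrt s t t hst le_rfl
  have iD : IntervalIntegrable (fun r => E * Dk (t - r) (s - r)) volume 0 s := by
    simp_rw [hD]
    exact ((j1.add j2).sub (j3.const_mul 2)).const_mul E
  have vD : ∫ r in (0 : ℝ)..s, E * Dk (t - r) (s - r) ≤ 4 * E * √(t - s) := by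
    simp_rw [hD]
    rw [intervalIntegral.integral_const_mul, intervalIntegral.integral_sub (j1.add j2)
      (j3.const_mul 2), intervalIntegral.integral_add j1 j2, intervalIntegral.integral_const_mul,
      int_inv_sqrt _ _ _ (by linarith) hst, int_inv_sqrt _ _ _ hs le_rfl,
      int_inv_sqrt _ _ _ (by linarith) (by linarith)]
    simp only [sub_zero, sub_self, Real.sqrt_zero]
    have c1 : √t + √s ≤ 2 * √((t + s) / 2) := by
      have e1 := Real.sq_sqrt (hs.trans hst)
      have e2 := Real.sq_sqrt hs
      have e3 := Real.sq_sqrt (show 0 ≤ (t + s) / 2 by linarith)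
      have := Real.sqrt_nonneg ((t + s) / 2)
      refine (abs_le_of_sq_le_sq' ?_ (by positivity)).2
      nlinarith [sq_nonneg (√t - √s)]
    have c2 : √((t + s) / 2 - s) ≤ √(t - s) := Real.sqrt_le_sqrt (by linarith)
    have c3 := Real.sqrt_nonneg (t - s)
    rw [mul_comm 4 E, mul_assoc]
    apply mul_le_mul_of_nonneg_left _ Ep.le
    linarith
  have aeI : ∀ a b : ℝ, a ≤ b → ∀ P : ℝ → Prop, (∀ r, a < r → r < b → P r) →
      ∀ᵐ r ∂(volume.restrict (Set.uIoc a b)), P r := by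
    intro a b hab P hP
    rw [Set.uIoc_of_le hab, ← Measure.restrict_congr_set (Ioo_ae_eq_Ioc (μ := volume))]
    exact (ae_restrict_iff' measurableSet_Ioo).2
      (Filter.Eventually.of_forall fun r hr => hP r hr.1 hr.2)
  have iH1 : IntervalIntegrable H volume 0 s := by
    refine iD.mono_fun' hmeas.aestronglyMeasurable ?_
    refine aeI 0 s hs _ fun r _ hr => ?_
    show ‖H r‖ ≤ _
    rw [Real.norm_of_nonneg (H0 r)]
    exact H1 r hr
  have iH2 : IntervalIntegrable H volume s t := by
    refine (j4.const_mul B).mono_fun' hmeas.aestronglyMeasurable ?_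
    refine aeI s t hst _ fun r hr hr' => ?_
    show ‖H r‖ ≤ _
    rw [Real.norm_of_nonneg (H0 r), H2 r hr.le]
    exact up _ (by linarith)
  have v4 : ∫ r in s..t, (√(t - r))⁻¹ = 2 * √(t - s) := by
    rw [int_inv_sqrt _ _ _ hst le_rfl]; simp
  have b1 : ∫ r in (0 : ℝ)..s, H r ≤ 4 * E * √(t - s) :=
    (intervalIntegral.integral_mono_on_of_le_Ioo hs iH1 iD fun r hr => H1 r hr.2).trans vD
  have b0 : 0 ≤ ∫ r in (0 : ℝ)..s, H r := intervalIntegral.integral_nonneg hs fun r _ => H0 r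
  have b2 : ∫ r in s..t, H r ≤ B * (2 * √(t - s)) := by
    rw [← v4, ← intervalIntegral.integral_const_mul]
    refine intervalIntegral.integral_mono_on_of_le_Ioo hst iH2 (j4.const_mul B) fun r hr => ?_
    rw [H2 r hr.1.le]
    exact up _ (by linarith [hr.2])
  have b3 : A * (2 * √(t - s)) ≤ ∫ r in s..t, H r := by
    rw [← v4, ← intervalIntegral.integral_const_mul]
    refine intervalIntegral.integral_mono_on_of_le_Ioo hst (j4.const_mul A) iH2 fun r hr => ?_
    rw [H2 r hr.1.le]
    exact lo _ (by linarith [hr.2])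
  rw [← Real.sqrt_eq_rpow, ← intervalIntegral.integral_add_adjacent_intervals iH1 iH2]
  constructor <;> linarith
end
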